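/- Let V be a 6-dimensional real vector space with a fixed volume form θ, and for a 3-form ω define K_ω: V → V by K_ω(X) θ = A(i_X(ω) ∧ ω), where A: Λ⁵(V*) → V ⊗ Λ⁶(V*) is the isomorphism induced by exterior product, and set λ(ω) = (1/6) tr(K_ω ∘ K_ω). If λ(ω) ≠ 0, then K_ω ∘ K_ω = λ(ω) · Id. -/

import Mathlib

/- Framework: exterior forms on a real vector space `V` are modelled as elements of the
exterior algebra of the dual space; a `k`-form is an element of the submodule
`⋀[ℝ]^k (Module.Dual ℝ V)`, and the wedge product is the algebra multiplication. -/

noncomputable section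
open ExteriorAlgebra
set_option synthInstance.maxHeartbeats 1000000
set_option maxHeartbeats 1000000

variable (V : Type) [AddCommGroup V] [Module ℝ V]

/-- The algebra of exterior forms on `V`. -/
abbrev EForm := ExteriorAlgebra ℝ (Module.Dual ℝ V)

variable {V}

/-- Interior product (contraction) of forms by a vector, linear in the vector. -/
def iContrL : V →ₗ[ℝ] Module.End ℝ (EForm V) :=
  (CliffordAlgebra.contractLeft (Q := (0 : QuadraticForm ℝ (Module.Dual ℝ V)))).comp
    (Module.Dual.eval ℝ V)

/-- Contraction of forms by an arbitrary element of the exterior algebra of `V`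
(e.g. by a bivector), extending `iContrL` as an algebra morphism. -/
def aContr : ExteriorAlgebra ℝ V →ₐ[ℝ] Module.End ℝ (EForm V) :=
  ExteriorAlgebra.lift ℝ ⟨iContrL, fun _ =>
    LinearMap.ext fun _ => CliffordAlgebra.contractLeft_contractLeft _ _⟩

/-- The bilinear form on `V` associated with an exterior 2-form, via double contraction
(the scalar part is extracted by `ExteriorAlgebra.algebraMapInv`). -/
def formToBilin (Om : EForm V) : V →ₗ[ℝ] V →ₗ[ℝ] ℝ :=
  LinearMap.mk₂ ℝ (fun x y => algebraMapInv (iContrL y (iContrL x Om)))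
    (fun x x' y => by simp [map_add, LinearMap.add_apply])
    (fun c x y => by simp [map_smul, LinearMap.smul_apply])
    (fun x y y' => by simp [map_add, LinearMap.add_apply])
    (fun c x y => by simp [map_smul, LinearMap.smul_apply])

/-- A 2-form is nondegenerate (symplectic) if its associated bilinear form is. -/
def IsSymplecticForm (Om : EForm V) : Prop :=
  Om ∈ ⋀[ℝ]^2 (Module.Dual ℝ V) ∧ ∀ x : V, (∀ y : V, formToBilin Om x y = 0) → x = 0

/-- The algebra morphism `⋀ V → ⋀ V*` induced by a linear map `Γ : V → V*`. -/
def extAlgMap (f : V →ₗ[ℝ] Module.Dual ℝ V) : ExteriorAlgebra ℝ V →ₐ[ℝ] EForm V :=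
  ExteriorAlgebra.lift ℝ ⟨(ExteriorAlgebra.ι ℝ).comp f, fun _ => ι_sq_zero _⟩

/-- `XOm` is the bivector dual to the symplectic form `Om`, i.e. the unique bivector with
`Γ^*(X_Ω) = Ω` where `Γ : V → V*` is the isomorphism induced by `Om`. -/
def IsDualBivector (Om : EForm V) (XOm : ExteriorAlgebra ℝ V) : Prop :=
  XOm ∈ ⋀[ℝ]^2 V ∧ extAlgMap (formToBilin Om) XOm = Om

/-- The pullback action on forms induced by an endomorphism `K : V → V`. -/
def formPullback (K : V →ₗ[ℝ] V) : EForm V →ₐ[ℝ] EForm V :=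
  ExteriorAlgebra.lift ℝ ⟨(ExteriorAlgebra.ι ℝ).comp K.dualMap, fun _ => ι_sq_zero _⟩

theorem iContrL_ι_mul (X : V) (α : Module.Dual ℝ V) (b : EForm V) :
    iContrL X (ι ℝ α * b) = α X • b - ι ℝ α * iContrL X b :=
  CliffordAlgebra.contractLeft_ι_mul _ α b

theorem iContrL_algebraMap (X : V) (r : ℝ) :
    iContrL X (algebraMap ℝ (EForm V) r) = 0 :=
  CliffordAlgebra.contractLeft_algebraMap _ _ r

theorem iContrL_comm (X Y : V) (a : EForm V) :
    iContrL X (iContrL Y a) = -iContrL Y (iContrL X a) :=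
  CliffordAlgebra.contractLeft_comm _ _ a

theorem iContrL_mem {p : ℕ} (X : V) {a : EForm V}
    (ha : a ∈ ⋀[ℝ]^(p + 1) (Module.Dual ℝ V)) :
    iContrL X a ∈ ⋀[ℝ]^p (Module.Dual ℝ V) := by
  suffices H : ∀ (n : ℕ) (a : EForm V), a ∈ ⋀[ℝ]^n (Module.Dual ℝ V) →
      (n = 0 → iContrL X a = 0) ∧
      ∀ p, n = p + 1 → iContrL X a ∈ ⋀[ℝ]^p (Module.Dual ℝ V) from (H _ a ha).2 p rfl
  intro n a ha
  induction ha using Submodule.pow_induction_on_left' with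
  | algebraMap r => exact ⟨fun _ => iContrL_algebraMap X r, fun p h => by omega⟩
  | add x y i hx hy ihx ihy =>
    refine ⟨fun h => by rw [map_add, ihx.1 h, ihy.1 h, add_zero], fun p h => ?_⟩
    rw [map_add]
    exact add_mem (ihx.2 p h) (ihy.2 p h)
  | mem_mul m hm i x hx ih =>
    obtain ⟨α, rfl⟩ := hm
    refine ⟨fun h => by omega, fun p h => ?_⟩
    obtain rfl : i = p := by omega
    rw [iContrL_ι_mul]
    refine sub_mem (Submodule.smul_mem _ _ hx) ?_
    rcases i with _ | j
    · rw [ih.1 rfl, mul_zero]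
      exact zero_mem _
    · rw [exteriorPower, pow_succ']
      exact Submodule.mul_mem_mul ⟨α, rfl⟩ (ih.2 j rfl)

/-- Contraction is an antiderivation for the wedge product. -/
theorem iContrL_mul {p : ℕ} (X : V) {a : EForm V}
    (ha : a ∈ ⋀[ℝ]^p (Module.Dual ℝ V)) (b : EForm V) :
    iContrL X (a * b) = iContrL X a * b + (-1 : ℝ) ^ p • (a * iContrL X b) := by
  induction ha using Submodule.pow_induction_on_left' with
  | algebraMap r =>
    rw [iContrL_algebraMap, ← Algebra.smul_def, ← Algebra.smul_def, map_smul]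
    simp
  | add x y i hx hy ihx ihy =>
    rw [add_mul, map_add, ihx, ihy, map_add, add_mul, add_mul, smul_add]
    abel
  | mem_mul m hm i x hx ih =>
    obtain ⟨α, rfl⟩ := hm
    rw [mul_assoc, iContrL_ι_mul, iContrL_ι_mul, ih, pow_succ, mul_add, sub_mul, smul_mul_assoc,
      mul_smul_comm, mul_neg_one, neg_smul, mul_assoc, mul_assoc]
    abel

theorem ι_mul_eq_neg_one_pow_smul {p : ℕ} (α : Module.Dual ℝ V) {a : EForm V}
    (ha : a ∈ ⋀[ℝ]^p (Module.Dual ℝ V)) :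
    ι ℝ α * a = (-1 : ℝ) ^ p • (a * ι ℝ α) := by
  induction ha using Submodule.pow_induction_on_left' with
  | algebraMap r => simpa using (Algebra.commutes r (ι ℝ α)).symm
  | add x y i hx hy ihx ihy => rw [mul_add, ihx, ihy, add_mul, smul_add]
  | mem_mul m hm i x hx ih =>
    obtain ⟨β, rfl⟩ := hm
    have h : ι ℝ α * ι ℝ β = -(ι ℝ β * ι ℝ α) := eq_neg_of_add_eq_zero_left (ι_add_mul_swap α β)
    rw [← mul_assoc, h, neg_mul, mul_assoc, ih, mul_smul_comm, pow_succ, mul_neg_one, neg_smul,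
      mul_assoc]

/-- The wedge product is graded commutative. -/
theorem eform_mul_comm {p q : ℕ} {a b : EForm V}
    (ha : a ∈ ⋀[ℝ]^p (Module.Dual ℝ V)) (hb : b ∈ ⋀[ℝ]^q (Module.Dual ℝ V)) :
    a * b = (-1 : ℝ) ^ (p * q) • (b * a) := by
  induction ha using Submodule.pow_induction_on_left' with
  | algebraMap r => simpa using Algebra.commutes r b
  | add x y i hx hy ihx ihy => rw [mul_add, add_mul, ihx, ihy, smul_add]
  | mem_mul m hm i x hx ih =>
    obtain ⟨β, rfl⟩ := hm
    rw [mul_assoc, ih, mul_smul_comm, ← mul_assoc, ι_mul_eq_neg_one_pow_smul β hb,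
      smul_mul_assoc, smul_smul, ← pow_add, mul_assoc, Nat.succ_mul]

theorem eform_mul_comm_of_even {p q : ℕ} {a b : EForm V}
    (ha : a ∈ ⋀[ℝ]^p (Module.Dual ℝ V)) (hb : b ∈ ⋀[ℝ]^q (Module.Dual ℝ V))
    (h : Even (p * q)) : a * b = b * a := by
  rw [eform_mul_comm ha hb, h.neg_one_pow, one_smul]

section Derivation

variable [FiniteDimensional ℝ V]

/-- The derivation of the algebra of forms extending the transpose of `K` on 1-forms. -/
def formDeriv (K : V →ₗ[ℝ] V) : Module.End ℝ (EForm V) :=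
  ∑ i, (LinearMap.mulLeft ℝ (ι ℝ ((Module.finBasis ℝ V).coord i))).comp
    (iContrL (K (Module.finBasis ℝ V i)))

theorem formDeriv_apply (K : V →ₗ[ℝ] V) (a : EForm V) :
    formDeriv K a = ∑ i, ι ℝ ((Module.finBasis ℝ V).coord i) *
      iContrL (K (Module.finBasis ℝ V i)) a := by
  simp [formDeriv, LinearMap.sum_apply]

theorem formDeriv_algebraMap (K : V →ₗ[ℝ] V) (r : ℝ) :
    formDeriv K (algebraMap ℝ (EForm V) r) = 0 := by
  simp [formDeriv_apply, iContrL_algebraMap]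

theorem sum_smul_ι_coord (K : V →ₗ[ℝ] V) (α : Module.Dual ℝ V) :
    ∑ i, α (K (Module.finBasis ℝ V i)) • ι ℝ ((Module.finBasis ℝ V).coord i) =
      ι ℝ (α ∘ₗ K) := by
  simp_rw [← map_smul, ← map_sum]
  congr 1
  refine (Module.finBasis ℝ V).ext fun j => ?_
  simp [LinearMap.sum_apply, Finsupp.single_apply]

theorem formDeriv_ι_mul (K : V →ₗ[ℝ] V) (α : Module.Dual ℝ V) (b : EForm V) :
    formDeriv K (ι ℝ α * b) = ι ℝ (α ∘ₗ K) * b + ι ℝ α * formDeriv K b := by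
  rw [formDeriv_apply, formDeriv_apply, ← sum_smul_ι_coord, Finset.sum_mul, Finset.mul_sum,
    ← Finset.sum_add_distrib]
  refine Finset.sum_congr rfl fun i _ => ?_
  have h : ι ℝ ((Module.finBasis ℝ V).coord i) * ι ℝ α =
      -(ι ℝ α * ι ℝ ((Module.finBasis ℝ V).coord i)) :=
    eq_neg_of_add_eq_zero_left (ι_add_mul_swap _ _)
  rw [iContrL_ι_mul, mul_sub, mul_smul_comm, smul_mul_assoc, ← mul_assoc, h, neg_mul,
    sub_neg_eq_add, mul_assoc]

theorem formDeriv_mul (K : V →ₗ[ℝ] V) (a b : EForm V) :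
    formDeriv K (a * b) = formDeriv K a * b + a * formDeriv K b := by
  induction a using CliffordAlgebra.left_induction with
  | algebraMap r =>
    rw [formDeriv_algebraMap, ← Algebra.smul_def, ← Algebra.smul_def, map_smul]
    simp
  | add x y hx hy =>
    rw [add_mul, map_add, hx, hy, map_add, add_mul, add_mul]
    abel
  | ι_mul x α hx =>
    change formDeriv K (ι ℝ α * x * b) = formDeriv K (ι ℝ α * x) * b + ι ℝ α * x * formDeriv K b
    rw [mul_assoc, formDeriv_ι_mul, hx, formDeriv_ι_mul]
    noncomm_ring

theorem iContrL_formDeriv (K : V →ₗ[ℝ] V) (X : V) (a : EForm V) :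
    iContrL X (formDeriv K a) = formDeriv K (iContrL X a) + iContrL (K X) a := by
  induction a using CliffordAlgebra.left_induction with
  | algebraMap r =>
    rw [formDeriv_algebraMap, iContrL_algebraMap, iContrL_algebraMap, map_zero, map_zero, add_zero]
  | add x y hx hy =>
    rw [map_add, map_add, hx, hy, map_add, map_add, map_add]
    abel
  | ι_mul x α hx =>
    change iContrL X (formDeriv K (ι ℝ α * x)) = formDeriv K (iContrL X (ι ℝ α * x)) +
      iContrL (K X) (ι ℝ α * x)
    rw [formDeriv_ι_mul, map_add, iContrL_ι_mul, iContrL_ι_mul, iContrL_ι_mul, iContrL_ι_mul, hx,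
      map_sub, map_smul, formDeriv_ι_mul, mul_add, LinearMap.comp_apply]
    abel

/-- Euler's identity: the derivation attached to the identity multiplies `p`-forms by `p`. -/
theorem formDeriv_id {p : ℕ} {a : EForm V} (ha : a ∈ ⋀[ℝ]^p (Module.Dual ℝ V)) :
    formDeriv LinearMap.id a = (p : ℝ) • a := by
  induction ha using Submodule.pow_induction_on_left' with
  | algebraMap r => simp [formDeriv_algebraMap]
  | add x y i hx hy ihx ihy => rw [map_add, ihx, ihy, smul_add]
  | mem_mul m hm i x hx ih =>
    obtain ⟨α, rfl⟩ := hm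
    rw [formDeriv_ι_mul, ih, LinearMap.comp_id, mul_smul_comm, Nat.cast_succ, add_smul, one_smul,
      add_comm]

theorem formDeriv_mem {p : ℕ} (K : V →ₗ[ℝ] V) {a : EForm V}
    (ha : a ∈ ⋀[ℝ]^p (Module.Dual ℝ V)) : formDeriv K a ∈ ⋀[ℝ]^p (Module.Dual ℝ V) := by
  induction ha using Submodule.pow_induction_on_left' with
  | algebraMap r =>
    rw [formDeriv_algebraMap]
    exact zero_mem _
  | add x y i hx hy ihx ihy =>
    rw [map_add]
    exact add_mem ihx ihy
  | mem_mul m hm i x hx ih =>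
    obtain ⟨α, rfl⟩ := hm
    rw [formDeriv_ι_mul, exteriorPower, pow_succ']
    exact add_mem (Submodule.mul_mem_mul ⟨_, rfl⟩ hx) (Submodule.mul_mem_mul ⟨_, rfl⟩ ih)

theorem eq_zero_of_iContrL_eq_zero {p : ℕ} {a : EForm V}
    (ha : a ∈ ⋀[ℝ]^(p + 1) (Module.Dual ℝ V)) (h : ∀ X, iContrL X a = 0) : a = 0 := by
  have h1 := formDeriv_id ha
  rw [formDeriv_apply] at h1
  simp only [h, mul_zero, Finset.sum_const_zero] at h1
  refine (smul_eq_zero.mp h1.symm).resolve_left ?_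
  positivity

theorem eform_eq_zero_of_finrank_lt {p : ℕ} (hp : Module.finrank ℝ V < p) {a : EForm V}
    (ha : a ∈ ⋀[ℝ]^p (Module.Dual ℝ V)) : a = 0 := by
  have h : Module.finrank ℝ (⋀[ℝ]^p (Module.Dual ℝ V)) = 0 := by
    rw [exteriorPower.finrank_eq, Subspace.dual_finrank_eq, Nat.choose_eq_zero_of_lt hp]
  rw [Submodule.finrank_eq_zero] at h
  rwa [h, Submodule.mem_bot] at ha

theorem exists_smul_eq_of_top_degree {p : ℕ} (hp : Module.finrank ℝ V = p) {θ a : EForm V}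
    (hθ : θ ∈ ⋀[ℝ]^p (Module.Dual ℝ V)) (hθ0 : θ ≠ 0)
    (ha : a ∈ ⋀[ℝ]^p (Module.Dual ℝ V)) : ∃ c : ℝ, c • θ = a := by
  have h : Module.finrank ℝ (⋀[ℝ]^p (Module.Dual ℝ V)) = 1 := by
    rw [exteriorPower.finrank_eq, Subspace.dual_finrank_eq, hp, Nat.choose_self]
  obtain ⟨c, hc⟩ := exists_smul_eq_of_finrank_eq_one h (x := ⟨θ, hθ⟩)
    (by simpa [Subtype.ext_iff] using hθ0) ⟨a, ha⟩
  exact ⟨c, congrArg Subtype.val hc⟩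

/-- A 1-form wedged with the contraction of a form of top degree. -/
theorem mul_iContrL_of_top_degree {p : ℕ} (hp : Module.finrank ℝ V = p) {θ β : EForm V}
    (hθ : θ ∈ ⋀[ℝ]^p (Module.Dual ℝ V)) (hβ : β ∈ ⋀[ℝ]^1 (Module.Dual ℝ V)) (X : V) :
    β * iContrL X θ = iContrL X β * θ := by
  have hmem : β * θ ∈ ⋀[ℝ]^(1 + p) (Module.Dual ℝ V) := by
    rw [exteriorPower, pow_add]
    exact Submodule.mul_mem_mul hβ hθ
  have h := iContrL_mul X hβ θ
  rw [eform_eq_zero_of_finrank_lt (by omega) hmem, map_zero, pow_one, neg_one_smul] at h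
  exact (eq_of_sub_eq_zero (by rw [sub_eq_add_neg]; exact h.symm)).symm

theorem eq_zero_of_iContrL_top_degree_eq_zero {p : ℕ} (hp : Module.finrank ℝ V = p)
    {θ : EForm V} (hθ : θ ∈ ⋀[ℝ]^p (Module.Dual ℝ V)) (hθ0 : θ ≠ 0) {X : V}
    (hX : iContrL X θ = 0) : X = 0 := by
  rw [← Module.forall_dual_apply_eq_zero_iff ℝ X]
  intro α
  have h := mul_iContrL_of_top_degree hp hθ (β := ι ℝ α) (by simp [exteriorPower]) X
  have h2 : iContrL X (ι ℝ α) = algebraMap ℝ (EForm V) (α X) :=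
    CliffordAlgebra.contractLeft_ι _ _ α
  rw [hX, mul_zero, h2, ← Algebra.smul_def] at h
  exact (smul_eq_zero.mp h.symm).resolve_right hθ0

end Derivation

section Hitchin

variable [FiniteDimensional ℝ V]

/-- If `i_X ω ∧ ω = i_{K X} θ`, then `(X, Y, Z) ↦ ω (K X, Y, Z)` is alternating. -/
theorem iContrL_iContrL_hitchin_symm (hdim : Module.finrank ℝ V = 6) {θ ω : EForm V}
    (hθ : θ ∈ ⋀[ℝ]^6 (Module.Dual ℝ V)) (hθ0 : θ ≠ 0) (hω : ω ∈ ⋀[ℝ]^3 (Module.Dual ℝ V))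
    {K : V →ₗ[ℝ] V} (hK : ∀ X : V, iContrL X ω * ω = iContrL (K X) θ) (X Y : V) :
    iContrL Y (iContrL (K X) ω) = iContrL (K Y) (iContrL X ω) := by
  have h2 : ∀ X, iContrL X ω ∈ ⋀[ℝ]^2 (Module.Dual ℝ V) := fun X => iContrL_mem X hω
  have h1 : ∀ X Y, iContrL Y (iContrL X ω) ∈ ⋀[ℝ]^1 (Module.Dual ℝ V) :=
    fun X Y => iContrL_mem Y (h2 X)
  have hA : ∀ X Y Z, iContrL Z (iContrL Y ω) * (iContrL X ω * ω) =
      iContrL (K X) (iContrL Z (iContrL Y ω)) * θ := fun X Y Z => by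
    rw [hK, mul_iContrL_of_top_degree hdim hθ (h1 Y Z)]
  have hcomm : ∀ X Y Z, iContrL Y ω * iContrL Z (iContrL X ω) =
      iContrL Z (iContrL X ω) * iContrL Y ω := fun X Y Z =>
    eform_mul_comm_of_even (h2 Y) (h1 X Z) (by decide)
  have hcomm2 : ∀ X Y, iContrL X ω * iContrL Y ω = iContrL Y ω * iContrL X ω := fun X Y =>
    eform_mul_comm_of_even (h2 X) (h2 Y) (by decide)
  have hS : ∀ X Y Z, iContrL (K X) (iContrL Z (iContrL Y ω)) * θ +
      iContrL (K Y) (iContrL Z (iContrL X ω)) * θ +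
      iContrL X ω * iContrL Y ω * iContrL Z ω = 0 := fun X Y Z => by
    have hmem : iContrL Y ω * (iContrL X ω * ω) ∈ ⋀[ℝ]^(2 + (2 + 3)) (Module.Dual ℝ V) := by
      rw [exteriorPower, pow_add, pow_add _ 2 3]
      exact Submodule.mul_mem_mul (h2 Y) (Submodule.mul_mem_mul (h2 X) hω)
    have h := iContrL_mul Z (h2 Y) (iContrL X ω * ω)
    rw [eform_eq_zero_of_finrank_lt (by omega) hmem, map_zero, iContrL_mul Z (h2 X)] at h
    rw [← hA, ← hA, h, hcomm2 X]
    simp only [neg_one_sq, one_smul, mul_add, ← mul_assoc]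
    rw [hcomm]
    abel
  have hsymm : ∀ X Y Z, iContrL (K X) (iContrL Z (iContrL Y ω)) * θ =
      -(iContrL (K X) (iContrL Y (iContrL Z ω)) * θ) := fun X Y Z => by
    rw [iContrL_comm Z Y, map_neg, neg_mul]
  have hzero : ∀ X Y Z, iContrL X ω * iContrL Y ω * iContrL Z ω = 0 := fun X Y Z => by
    have c1 : iContrL Z ω * iContrL Y ω * iContrL X ω =
        iContrL X ω * iContrL Y ω * iContrL Z ω := by
      rw [hcomm2 Z Y, mul_assoc, hcomm2 Z X, ← mul_assoc, hcomm2 Y X]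
    have c2 : iContrL X ω * iContrL Z ω * iContrL Y ω =
        iContrL X ω * iContrL Y ω * iContrL Z ω := by
      rw [mul_assoc, hcomm2 Z Y, mul_assoc]
    have e1 := hS X Y Z
    have e2 := hS Z Y X
    have e3 := hS X Z Y
    rw [c1] at e2
    rw [c2] at e3
    have h3 : (3 : ℝ) • (iContrL X ω * iContrL Y ω * iContrL Z ω) = 0 := by
      linear_combination (norm := module) e1 + e2 + e3 - hsymm X Y Z - hsymm Y X Z - hsymm Z X Y
    exact (smul_eq_zero.mp h3).resolve_left (by norm_num)
  refine eq_of_sub_eq_zero (eq_zero_of_iContrL_eq_zero (p := 0) (sub_mem (h1 _ _) (h1 _ _)) ?_)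
  intro Z
  have h := hS X Y Z
  have hmem : iContrL (K X) (iContrL Z (iContrL Y ω)) + iContrL (K Y) (iContrL Z (iContrL X ω)) ∈
      ⋀[ℝ]^0 (Module.Dual ℝ V) := add_mem (iContrL_mem _ (h1 _ _)) (iContrL_mem _ (h1 _ _))
  rw [exteriorPower, pow_zero, Submodule.mem_one] at hmem
  obtain ⟨r, hr⟩ := hmem
  rw [hzero, add_zero, ← add_mul, ← hr, ← Algebra.smul_def] at h
  rw [(smul_eq_zero.mp h).resolve_right hθ0, map_zero, iContrL_comm (K X) Z, iContrL_comm (K X) Y,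
    iContrL_comm (K Y) Z] at hr
  rw [map_sub, sub_eq_add_neg, hr, map_neg, neg_neg]

end Hitchin

/-- Hitchin: for a 3-form `ω` on a 6-dimensional real vector space with volume form `θ`,
with `K_ω` defined by `i_X(ω) ∧ ω = i_{K_ω X} θ` and `λ(ω) = (1/6) tr(K_ω²)`, if
`λ(ω) ≠ 0` then `K_ω ∘ K_ω = λ(ω) • Id`. -/
theorem hitchin_K_sq [FiniteDimensional ℝ V]
    (hdim : Module.finrank ℝ V = 6)
    (θ : EForm V) (hθ : θ ∈ ⋀[ℝ]^6 (Module.Dual ℝ V)) (hθ0 : θ ≠ 0)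
    (ω : EForm V) (hω : ω ∈ ⋀[ℝ]^3 (Module.Dual ℝ V))
    (K : V →ₗ[ℝ] V)
    (hK : ∀ X : V, (iContrL X ω) * ω = iContrL (K X) θ)
    (hlam : (1/6 : ℝ) * LinearMap.trace ℝ V (K ∘ₗ K) ≠ 0) :
    K ∘ₗ K = ((1/6 : ℝ) * LinearMap.trace ℝ V (K ∘ₗ K)) • LinearMap.id := by
  have hself : ω * ω = 0 := by
    have h := eform_mul_comm hω hω
    have h2 : (2 : ℝ) • (ω * ω) = 0 := by linear_combination (norm := module) h
    exact (smul_eq_zero.mp h2).resolve_left two_ne_zero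
  have hKθ : formDeriv K θ = 0 := by
    simp_rw [formDeriv_apply, ← hK, ← mul_assoc, ← Finset.sum_mul]
    have h := formDeriv_id hω
    simp only [formDeriv_apply, LinearMap.id_apply] at h
    rw [h, smul_mul_assoc, hself, smul_zero]
  have hD : ∀ X, formDeriv K (iContrL X ω) = (2 : ℝ) • iContrL (K X) ω := fun X => by
    have h := formDeriv_id (iContrL_mem (K X) hω)
    rw [formDeriv_apply] at h ⊢
    simp only [LinearMap.id_apply,
      iContrL_iContrL_hitchin_symm hdim hθ hθ0 hω hK X] at h
    exact_mod_cast h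
  have hiD : ∀ X, iContrL X (formDeriv K ω) = (3 : ℝ) • iContrL (K X) ω := fun X => by
    rw [iContrL_formDeriv, hD]
    module
  have hW := formDeriv_mem K hω
  obtain ⟨c, hc⟩ : ∃ c : ℝ, c • θ = formDeriv K ω * ω := by
    refine exists_smul_eq_of_top_degree hdim hθ hθ0 ?_
    rw [exteriorPower, pow_add _ 3 3]
    exact Submodule.mul_mem_mul hW hω
  have key : ∀ X, K (K X) = (c / 6) • X := fun X => by
    have hA : c • iContrL X θ =
        (3 : ℝ) • iContrL (K (K X)) θ - iContrL X ω * formDeriv K ω := by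
      have hcomm : iContrL X ω * formDeriv K ω = formDeriv K ω * iContrL X ω := 
        eform_mul_comm_of_even (iContrL_mem X hω) hW (by decide)
      rw [← map_smul, hc, iContrL_mul X hW, hiD, smul_mul_assoc, hK, hcomm]
      norm_num [sub_eq_add_neg]
    have hB : -iContrL (K (K X)) θ =
        (2 : ℝ) • iContrL (K (K X)) θ + iContrL X ω * formDeriv K ω := by
      have h := iContrL_formDeriv K (K X) θ
      rw [hKθ, map_zero, ← hK X, formDeriv_mul, hD, smul_mul_assoc, hK] at h
      exact (eq_neg_of_add_eq_zero_left h.symm).symm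
    refine eq_of_sub_eq_zero (eq_zero_of_iContrL_top_degree_eq_zero hdim hθ hθ0 ?_)
    rw [map_sub, map_smul, LinearMap.sub_apply, LinearMap.smul_apply]
    linear_combination (norm := module) (-1 / 6 : ℝ) • hA - (1 / 6 : ℝ) • hB
  have hKK : K ∘ₗ K = (c / 6) • LinearMap.id := LinearMap.ext key
  have htr : (1/6 : ℝ) * LinearMap.trace ℝ V (K ∘ₗ K) = c / 6 := by
    rw [hKK, map_smul, LinearMap.trace_id, hdim, smul_eq_mul]
    push_cast
    ring
  rw [htr, hKK]
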